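/- arXiv:2002.02508 — 2 statements merged into one kernel-verified Lean document; each statement's English description precedes it below -/
import Mathlib

section
/- Nonasymptotic convergence of DQ-GD. Under the DQ-GD algorithm, for every t ≥ 1 the iterate satisfies ‖x̂_t − x*‖ ≤ max{σ_GD, ε}^t·(1 + η_GD·L·b_{t−1})·D, where b_s := ε/|σ_GD − ε| if σ_GD ≠ ε and b_s := s + 1 if σ_GD = ε. -/
section ConvexGradient

variable {F : Type*} [NormedAddCommGroup F] [InnerProductSpace ℝ F]

/-- Cocoercivity of the gradient map `g'` of a function `g` lying above its tangent planes and
below its tangent paraboloids of curvature `M`. -/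
theorem norm_sub_sq_le_mul_inner_of_tangent_bounds {g : F → ℝ} {g' : F → F} {M : ℝ} (hM : 0 ≤ M)
    (hlow : ∀ x y, g x + inner ℝ (g' x) (y - x) ≤ g y)
    (hupp : ∀ x y, g y ≤ g x + inner ℝ (g' x) (y - x) + M / 2 * ‖y - x‖ ^ 2) (x y : F) :
    ‖g' y - g' x‖ ^ 2 ≤ M * inner ℝ (g' y - g' x) (y - x) := by
  have one_sided (s : ℝ) (x y : F) :
      g x + inner ℝ (g' x) (y - x) + (s - M / 2 * s ^ 2) * ‖g' y - g' x‖ ^ 2 ≤ g y := by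
    have h1 := hlow x (y - s • (g' y - g' x))
    have h2 := hupp y (y - s • (g' y - g' x))
    have e1 : y - s • (g' y - g' x) - x = (y - x) - s • (g' y - g' x) := by abel
    have e2 : y - s • (g' y - g' x) - y = -(s • (g' y - g' x)) := by abel
    rw [e1, inner_sub_right, inner_smul_right] at h1
    rw [e2, inner_neg_right, inner_smul_right, norm_neg, norm_smul, mul_pow, Real.norm_eq_abs,
      sq_abs] at h2
    have h3 : inner ℝ (g' y) (g' y - g' x) - inner ℝ (g' x) (g' y - g' x)
        = ‖g' y - g' x‖ ^ 2 := by
      rw [← inner_sub_left, real_inner_self_eq_norm_sq]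
    rw [← h3] at h2 ⊢
    linarith
  have key (s : ℝ) :
      (2 * s - M * s ^ 2) * ‖g' y - g' x‖ ^ 2 ≤ inner ℝ (g' y - g' x) (y - x) := by
    have h1 := one_sided s x y
    have h2 := one_sided s y x
    rw [norm_sub_rev (g' x), ← neg_sub y x, inner_neg_right] at h2
    rw [inner_sub_left]
    linarith
  rcases hM.eq_or_lt with rfl | hM
  · rw [zero_mul]
    by_contra! hpos
    have hne : ‖g' y - g' x‖ ≠ 0 := (pow_ne_zero_iff two_ne_zero).1 hpos.ne'
    have h := key ((inner ℝ (g' y - g' x) (y - x) + 1) / (2 * ‖g' y - g' x‖ ^ 2))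
    have hcancel : (2 * ((inner ℝ (g' y - g' x) (y - x) + 1) / (2 * ‖g' y - g' x‖ ^ 2))
        - 0 * ((inner ℝ (g' y - g' x) (y - x) + 1) / (2 * ‖g' y - g' x‖ ^ 2)) ^ 2)
        * ‖g' y - g' x‖ ^ 2 = inner ℝ (g' y - g' x) (y - x) + 1 := by
      field_simp
      ring
    linarith
  · have h := mul_le_mul_of_nonneg_left (key (1 / M)) hM.le
    have hcancel : M * ((2 * (1 / M) - M * (1 / M) ^ 2) * ‖g' y - g' x‖ ^ 2)
        = ‖g' y - g' x‖ ^ 2 := by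
      field_simp
      ring
    linarith

variable [CompleteSpace F]

theorem HasGradientAt.hasDerivAt_comp_line {g : F → ℝ} {g' x v : F} {t : ℝ}
    (hg : HasGradientAt g g' (x + t • v)) :
    HasDerivAt (fun s : ℝ => g (x + s • v)) (inner ℝ g' v) t := by
  have hline : HasDerivAt (fun s : ℝ => x + s • v) v t := by
    simpa using ((hasDerivAt_id t).smul_const v).const_add x
  exact (hg.hasFDerivAt.comp_hasDerivAt t hline).congr_deriv (by simp)

theorem ConvexOn.add_inner_gradient_le {g : F → ℝ} (hg : ConvexOn ℝ Set.univ g) {g' x : F}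
    (hx : HasGradientAt g g' x) (y : F) : g x + inner ℝ g' (y - x) ≤ g y := by
  have hline : ConvexOn ℝ Set.univ (fun s : ℝ => g (x + s • (y - x))) := by
    have h := hg.comp_affineMap (AffineMap.lineMap x y : ℝ →ᵃ[ℝ] F)
    have heq : g ∘ (AffineMap.lineMap x y : ℝ →ᵃ[ℝ] F) = fun s : ℝ => g (x + s • (y - x)) := by
      ext s
      simp [AffineMap.lineMap_apply, add_comm]
    rwa [Set.preimage_univ, heq] at h
  have hderiv : HasDerivAt (fun s : ℝ => g (x + s • (y - x))) (inner ℝ g' (y - x)) 0 :=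
    HasGradientAt.hasDerivAt_comp_line (by simpa using hx)
  have h := hline.le_slope_of_hasDerivAt (Set.mem_univ 0) (Set.mem_univ 1) one_pos hderiv
  simp only [slope_def_field, one_smul, zero_smul, add_zero, sub_zero, div_one,
    add_sub_cancel] at h
  linarith

/-- The descent lemma. -/
theorem le_add_inner_add_of_lipschitz_gradient {f : F → ℝ} {f' : F → F} {L : ℝ}
    (hf : ∀ x, HasGradientAt f (f' x) x) (hL : ∀ x y, ‖f' x - f' y‖ ≤ L * ‖x - y‖) (x y : F) :
    f y ≤ f x + inner ℝ (f' x) (y - x) + L / 2 * ‖y - x‖ ^ 2 := by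
  have hderiv (t : ℝ) : HasDerivAt
      (fun s : ℝ => f (x + s • (y - x)) - s * inner ℝ (f' x) (y - x)
        - s ^ 2 * (L / 2 * ‖y - x‖ ^ 2))
      (inner ℝ (f' (x + t • (y - x))) (y - x) - inner ℝ (f' x) (y - x)
        - 2 * t * (L / 2 * ‖y - x‖ ^ 2)) t := by
    have h1 := (hf (x + t • (y - x))).hasDerivAt_comp_line
    have h2 := (hasDerivAt_id t).mul_const (inner ℝ (f' x) (y - x))
    have h3 := (hasDerivAt_pow 2 t).mul_const (L / 2 * ‖y - x‖ ^ 2)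
    exact ((h1.sub h2).sub h3).congr_deriv (by simp)
  have hanti := antitoneOn_of_hasDerivWithinAt_nonpos (convex_Icc (0 : ℝ) 1)
    (fun t _ => (hderiv t).continuousAt.continuousWithinAt)
    (fun t _ => (hderiv t).hasDerivWithinAt) (fun t ht => by
      rw [interior_Icc] at ht
      have h1 := real_inner_le_norm (f' (x + t • (y - x)) - f' x) (y - x)
      have h2 := hL (x + t • (y - x)) x
      rw [add_sub_cancel_left, norm_smul, Real.norm_of_nonneg ht.1.le] at h2
      have h3 := mul_le_mul_of_nonneg_right h2 (norm_nonneg (y - x))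
      rw [inner_sub_left] at h1
      linarith)
  have h := hanti (Set.left_mem_Icc.2 zero_le_one) (Set.right_mem_Icc.2 zero_le_one) zero_le_one
  simp only [one_smul, zero_smul, add_zero, add_sub_cancel] at h
  linarith

theorem HasGradientAt.sub_mul_norm_sq {f : F → ℝ} {f' x : F} (hf : HasGradientAt f f' x) (μ : ℝ) :
    HasGradientAt (fun z => f z - μ / 2 * ‖z‖ ^ 2) (f' - μ • x) x := by
  rw [hasGradientAt_iff_hasFDerivAt] at hf ⊢
  have h := hf.sub ((hasStrictFDerivAt_norm_sq x).hasFDerivAt.const_mul (μ / 2))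
  refine h.congr_fderiv ?_
  ext v
  simp
  ring

/-- A gradient step of length `2 / (L + μ)` on an `L`-smooth and `μ`-strongly convex function
contracts distances by the factor `(L - μ) / (L + μ)`. -/
theorem norm_gradient_step_sub_le {f : F → ℝ} {f' : F → F} {L μ : ℝ} (hμ : 0 < μ) (hμL : μ ≤ L)
    (hf : ∀ x, HasGradientAt f (f' x) x) (hL : ∀ x y, ‖f' x - f' y‖ ≤ L * ‖x - y‖)
    (hconv : ConvexOn ℝ Set.univ (fun x => f x - μ / 2 * ‖x‖ ^ 2)) (x y : F) :
    ‖(y - (2 / (L + μ)) • f' y) - (x - (2 / (L + μ)) • f' x)‖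
      ≤ (L - μ) / (L + μ) * ‖y - x‖ := by
  have hpos : 0 < L + μ := by linarith
  have hco := norm_sub_sq_le_mul_inner_of_tangent_bounds
    (g := fun x => f x - μ / 2 * ‖x‖ ^ 2) (g' := fun x => f' x - μ • x) (sub_nonneg.2 hμL)
    (fun x y => hconv.add_inner_gradient_le ((hf x).sub_mul_norm_sq μ) y)
    (fun x y => by
      have h := le_add_inner_add_of_lipschitz_gradient hf hL x y
      have hsq : ‖y‖ ^ 2 = ‖x‖ ^ 2 + 2 * inner ℝ x (y - x) + ‖y - x‖ ^ 2 := by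
        rw [← norm_add_sq_real, add_sub_cancel]
      simp only [inner_sub_left, real_inner_smul_left, hsq]
      linarith) x y
  set d : F := (f' y - μ • y) - (f' x - μ • x) with hd
  set σ : ℝ := (L - μ) / (L + μ) with hσ
  have hσ0 : 0 ≤ σ := div_nonneg (sub_nonneg.2 hμL) hpos.le
  have hstep : (y - (2 / (L + μ)) • f' y) - (x - (2 / (L + μ)) • f' x)
      = σ • (y - x) - (2 / (L + μ)) • d := by
    have hσ1 : σ = 1 - 2 / (L + μ) * μ := by
      rw [hσ]
      field_simp
      ring
    rw [hσ1, hd]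
    module
  have hη : (2 / (L + μ)) * (L - μ) = 2 * σ := by
    rw [hσ]
    ring
  have hη0 : 0 < 2 / (L + μ) := by positivity
  rw [hstep]
  refine le_of_sq_le_sq ?_ (by positivity)
  rw [norm_sub_sq_real, norm_smul, norm_smul, Real.norm_of_nonneg hσ0, Real.norm_of_nonneg hη0.le,
    real_inner_smul_left, real_inner_smul_right, real_inner_comm]
  have h := mul_le_mul_of_nonneg_left hco (sq_nonneg (2 / (L + μ)))
  have hη2 : (2 / (L + μ)) ^ 2 * ((L - μ) * inner ℝ d (y - x))
      = 2 * (2 / (L + μ)) * σ * inner ℝ d (y - x) := by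
    linear_combination (2 / (L + μ)) * inner ℝ d (y - x) * hη
  rw [hη2] at h
  rw [mul_pow (2 / (L + μ))]
  linarith

end ConvexGradient

section DynamicRange

variable {r : ℕ → ℝ} {σ ε c : ℝ}

theorem dynamic_range_nonneg (hσ : 0 ≤ σ) (hε : 0 ≤ ε) (hc : 0 ≤ c) (hr0 : r 0 = c)
    (hr : ∀ t, r (t + 1) = σ ^ (t + 1) * c + ε * r t) (t : ℕ) : 0 ≤ r t := by
  induction t with
  | zero => rwa [hr0]
  | succ t ih =>
    rw [hr]
    positivity

theorem dynamic_range_mul_sub (hr0 : r 0 = c)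
    (hr : ∀ t, r (t + 1) = σ ^ (t + 1) * c + ε * r t) (t : ℕ) :
    r t * (σ - ε) = (σ ^ (t + 1) - ε ^ (t + 1)) * c := by
  induction t with
  | zero =>
    rw [hr0]
    ring
  | succ t ih =>
    rw [hr]
    linear_combination ε * ih

theorem dynamic_range_of_eq (hr0 : r 0 = c)
    (hr : ∀ t, r (t + 1) = ε ^ (t + 1) * c + ε * r t) (t : ℕ) :
    r t = (t + 1) * ε ^ t * c := by
  induction t with
  | zero => simp [hr0]
  | succ t ih =>
    rw [hr, ih]
    push_cast
    ring

theorem mul_dynamic_range_le (hσ : 0 ≤ σ) (hε : 0 ≤ ε) (hc : 0 ≤ c) (hr0 : r 0 = c)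
    (hr : ∀ t, r (t + 1) = σ ^ (t + 1) * c + ε * r t) (t : ℕ) :
    ε * r t ≤ max σ ε ^ (t + 1) * (if σ = ε then (t : ℝ) + 1 else ε / |σ - ε|) * c := by
  split_ifs with h
  · subst h
    rw [dynamic_range_of_eq hr0 hr, max_self]
    exact le_of_eq (by ring)
  · have hpos : 0 < |σ - ε| := abs_pos.2 (sub_ne_zero.2 h)
    have hrabs : r t * |σ - ε| = |σ ^ (t + 1) - ε ^ (t + 1)| * c := by
      have habs := congrArg abs (dynamic_range_mul_sub hr0 hr t)
      rwa [abs_mul, abs_mul, abs_of_nonneg hc,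
        abs_of_nonneg (dynamic_range_nonneg hσ hε hc hr0 hr t)] at habs
    have hpow : |σ ^ (t + 1) - ε ^ (t + 1)| ≤ max σ ε ^ (t + 1) := by
      have h1 : σ ^ (t + 1) ≤ max σ ε ^ (t + 1) := pow_le_pow_left₀ hσ (le_max_left _ _) _
      have h2 : ε ^ (t + 1) ≤ max σ ε ^ (t + 1) := pow_le_pow_left₀ hε (le_max_right _ _) _
      have h3 : 0 ≤ σ ^ (t + 1) := by positivity
      have h4 : 0 ≤ ε ^ (t + 1) := by positivity
      exact abs_le.2 ⟨by linarith, by linarith⟩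
    rw [eq_div_of_mul_eq hpos.ne' hrabs]
    calc ε * (|σ ^ (t + 1) - ε ^ (t + 1)| * c / |σ - ε|)
        ≤ ε * (max σ ε ^ (t + 1) * c / |σ - ε|) := by gcongr
      _ = max σ ε ^ (t + 1) * (ε / |σ - ε|) * c := by ring

end DynamicRange

theorem norm_smul_quantizer_sub_le {F : Type*} [NormedAddCommGroup F] [NormedSpace ℝ F]
    {q : F → F} {ε ρ : ℝ} (hq : ∀ v, ‖v‖ ≤ 1 → ‖q v - v‖ ≤ ε) (hρ : 0 < ρ) {u : F}
    (hu : ‖u‖ ≤ ρ) : ‖ρ • q (ρ⁻¹ • u) - u‖ ≤ ε * ρ := by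
  have hunit : ‖ρ⁻¹ • u‖ ≤ 1 := by
    rw [norm_smul, norm_inv, Real.norm_of_nonneg hρ.le]
    exact inv_mul_le_one_of_le₀ hu hρ.le
  have hsplit : ρ • q (ρ⁻¹ • u) - u = ρ • (q (ρ⁻¹ • u) - ρ⁻¹ • u) := by
    rw [smul_sub, smul_inv_smul₀ hρ.ne']
  rw [hsplit, norm_smul, Real.norm_of_nonneg hρ.le, mul_comm ε]
  exact mul_le_mul_of_nonneg_left (hq _ hunit) hρ.le

/-- Nonasymptotic convergence of DQ-GD. -/
theorem dqgd_nonasymptotic_convergence (n : ℕ) (hn : 1 ≤ n)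
    (L μ D : ℝ) (hμ : 0 < μ) (hμL : μ ≤ L) (hD : 0 < D)
    (ηGD σGD : ℝ) (hηGD : ηGD = 2 / (L + μ)) (hσGD : σGD = (L - μ) / (L + μ))
    (f : EuclideanSpace ℝ (Fin n) → ℝ) (hf : Differentiable ℝ f)
    (hsmooth : ∀ x y : EuclideanSpace ℝ (Fin n),
      ‖gradient f x - gradient f y‖ ≤ L * ‖x - y‖)
    (hconv : ConvexOn ℝ Set.univ (fun x : EuclideanSpace ℝ (Fin n) => f x - μ / 2 * ‖x‖ ^ 2))
    (xs : EuclideanSpace ℝ (Fin n)) (hmin : ∀ x, f xs ≤ f x)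
    (q : EuclideanSpace ℝ (Fin n) → EuclideanSpace ℝ (Fin n))
    (ε : ℝ) (hε : 0 < ε)
    (hq : ∀ v : EuclideanSpace ℝ (Fin n), ‖v‖ ≤ 1 → ‖q v - v‖ ≤ ε)
    (xh u e : ℕ → EuclideanSpace ℝ (Fin n)) (r : ℕ → ℝ)
    (hr0 : r 0 = L * D)
    (hr : ∀ t : ℕ, r (t + 1) = σGD ^ (t + 1) * L * D + ε * r t)
    (hu0 : u 0 = gradient f (xh 0))
    (hu : ∀ t : ℕ, u (t + 1) = gradient f (xh (t + 1) + ηGD • e t) - e t)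
    (he : ∀ t : ℕ, e t = r t • q ((r t)⁻¹ • u t) - u t)
    (hxh : ∀ t : ℕ, xh (t + 1) = xh t - ηGD • (u t + e t))
    (hinit : ‖xs - xh 0‖ ≤ D)
    (b : ℕ → ℝ)
    (hb : ∀ s : ℕ, b s = if σGD = ε then (s : ℝ) + 1 else ε / |σGD - ε|) :
    ∀ t : ℕ, 1 ≤ t →
      ‖xh t - xs‖ ≤ max σGD ε ^ t * (1 + ηGD * L * b (t - 1)) * D := by
  have hsum : 0 < L + μ := by linarith
  have hL : 0 < L := by linarith
  have hσ : 0 ≤ σGD := by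
    rw [hσGD]
    exact div_nonneg (sub_nonneg.2 hμL) hsum.le
  have hη : 0 < ηGD := by
    rw [hηGD]
    positivity
  have hLD : 0 < L * D := mul_pos hL hD
  have hr' (t : ℕ) : r (t + 1) = σGD ^ (t + 1) * (L * D) + ε * r t := by rw [hr, mul_assoc]
  have hrpos (t : ℕ) : 0 < r t := by
    induction t with
    | zero => rwa [hr0]
    | succ t ih =>
      rw [hr']
      positivity
  have hgrad0 : gradient f xs = 0 := by
    have hloc : IsLocalMin f xs := Filter.Eventually.of_forall hmin
    rw [gradient, hloc.fderiv_eq_zero, map_zero]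
  have hcontract (x : EuclideanSpace ℝ (Fin n)) :
      ‖x - ηGD • gradient f x - xs‖ ≤ σGD * ‖x - xs‖ := by
    have h := norm_gradient_step_sub_le hμ hμL (fun z => (hf z).hasGradientAt) hsmooth hconv xs x
    rwa [hgrad0, smul_zero, sub_zero, ← hηGD, ← hσGD] at h
  have hgrad (x : EuclideanSpace ℝ (Fin n)) : ‖gradient f x‖ ≤ L * ‖x - xs‖ := by
    simpa [hgrad0] using hsmooth x xs
  have hx0 : ‖xh 0 - xs‖ ≤ D := by rwa [norm_sub_rev]
  have hmain (t : ℕ) :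
      ‖xh (t + 1) + ηGD • e t - xs‖ ≤ σGD ^ (t + 1) * D ∧ ‖e t‖ ≤ ε * r t := by
    induction t with
    | zero =>
      constructor
      · have hstep : xh (0 + 1) + ηGD • e 0 - xs = xh 0 - ηGD • gradient f (xh 0) - xs := by
          rw [hxh, hu0]
          module
        rw [hstep, zero_add, pow_one]
        exact (hcontract _).trans (mul_le_mul_of_nonneg_left hx0 hσ)
      · rw [he]
        refine norm_smul_quantizer_sub_le hq (hrpos 0) ?_
        rw [hu0, hr0]
        exact (hgrad _).trans (mul_le_mul_of_nonneg_left hx0 hL.le)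
    | succ t ih =>
      constructor
      · have hstep : xh (t + 1 + 1) + ηGD • e (t + 1) - xs = xh (t + 1) + ηGD • e t
            - ηGD • gradient f (xh (t + 1) + ηGD • e t) - xs := by
          rw [hxh (t + 1), hu]
          module
        rw [hstep, pow_succ' σGD (t + 1), mul_assoc]
        exact (hcontract _).trans (mul_le_mul_of_nonneg_left ih.1 hσ)
      · rw [he (t + 1)]
        refine norm_smul_quantizer_sub_le hq (hrpos _) ?_
        rw [hu, hr']
        have h1 := mul_le_mul_of_nonneg_left ih.1 hL.le
        have h2 := hgrad (xh (t + 1) + ηGD • e t)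
        have h3 := norm_sub_le (gradient f (xh (t + 1) + ηGD • e t)) (e t)
        linarith [ih.2]
  intro t ht
  obtain ⟨t, rfl⟩ := Nat.exists_eq_add_of_le' ht
  obtain ⟨hz, het⟩ := hmain t
  have hrange := mul_dynamic_range_le hσ hε.le hLD.le hr0 hr' t
  rw [← hb t] at hrange
  have hsplit : xh (t + 1) - xs = (xh (t + 1) + ηGD • e t - xs) - ηGD • e t := by abel
  have hpow : σGD ^ (t + 1) * D ≤ max σGD ε ^ (t + 1) * D :=
    mul_le_mul_of_nonneg_right (pow_le_pow_left₀ hσ (le_max_left _ _) _) hD.le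
  rw [Nat.add_sub_cancel]
  calc ‖xh (t + 1) - xs‖
      ≤ ‖xh (t + 1) + ηGD • e t - xs‖ + ‖ηGD • e t‖ := by
        rw [hsplit]
        exact norm_sub_le _ _
    _ = ‖xh (t + 1) + ηGD • e t - xs‖ + ηGD * ‖e t‖ := by
        rw [norm_smul, Real.norm_of_nonneg hη.le]
    _ ≤ max σGD ε ^ (t + 1) * D + ηGD * (max σGD ε ^ (t + 1) * b t * (L * D)) :=
        add_le_add (hz.trans hpow) (mul_le_mul_of_nonneg_left (het.trans hrange) hη.le)
    _ = max σGD ε ^ (t + 1) * (1 + ηGD * L * b t) * D := by ring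
end

section
/- Convergence of unquantized AGD. Let f : E → ℝ be differentiable, L-smooth and μ-strongly convex with 0 < μ < L and minimizer x*. Then the AGD iterates satisfy, for every t ≥ 0, ‖y_t − x*‖ ≤ σ_AGD^t·√(κ+1)·‖x_0 − x*‖ and ‖x_t − x*‖ ≤ σ_AGD^t·λ·‖x_0 − x*‖. -/
section HilbertSpace

variable {F : Type*} [NormedAddCommGroup F] [InnerProductSpace ℝ F]

theorem norm_add_smul_sub_smul_sq (a b g : F) (r c : ℝ) :
    ‖a + r • b - c • g‖ ^ 2 = ‖a‖ ^ 2 + r ^ 2 * ‖b‖ ^ 2 + c ^ 2 * ‖g‖ ^ 2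
      + 2 * r * inner ℝ a b - 2 * c * inner ℝ a g - 2 * r * c * inner ℝ b g := by
  rw [norm_sub_sq_real, norm_add_sq_real, inner_add_left]
  simp only [inner_smul_left, inner_smul_right, norm_smul, mul_pow, Real.norm_eq_abs, sq_abs,
    conj_trivial]
  ring

variable [CompleteSpace F]

theorem hasDerivAt_comp_line {f : F → ℝ} (hf : Differentiable ℝ f) (x d : F) (t : ℝ) :
    HasDerivAt (fun s : ℝ => f (x + s • d)) (inner ℝ (gradient f (x + t • d)) d) t := by
  have hline : HasDerivAt (fun s : ℝ => x + s • d) d t := by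
    simpa using ((hasDerivAt_id t).smul_const d).const_add x
  have h := (hf (x + t • d)).hasGradientAt.hasFDerivAt.comp_hasDerivAt t hline
  simpa [Function.comp_def] using h

theorem le_quadratic_of_gradient_lipschitz {f : F → ℝ} (hf : Differentiable ℝ f) {L : ℝ}
    (hsmooth : ∀ x y, ‖gradient f x - gradient f y‖ ≤ L * ‖x - y‖) (x d : F) :
    f (x + d) ≤ f x + inner ℝ (gradient f x) d + L / 2 * ‖d‖ ^ 2 := by
  have hderiv := hasDerivAt_comp_line hf x d
  have hquad (t : ℝ) : HasDerivAt
      (fun s : ℝ => f x + s * inner ℝ (gradient f x) d + L / 2 * ‖d‖ ^ 2 * s ^ 2)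
      (inner ℝ (gradient f x) d + L * ‖d‖ ^ 2 * t) t := by
    have h := (((hasDerivAt_id t).mul_const (inner ℝ (gradient f x) d)).const_add (f x)).add
      ((hasDerivAt_pow 2 t).const_mul (L / 2 * ‖d‖ ^ 2))
    refine h.congr_deriv ?_
    push_cast
    ring
  have hle := image_le_of_deriv_right_le_deriv_boundary (a := 0) (b := 1)
    (fun t _ => (hderiv t).continuousAt.continuousWithinAt)
    (fun t _ => (hderiv t).hasDerivWithinAt) (by simp)
    (fun t _ => (hquad t).continuousAt.continuousWithinAt)
    (fun t _ => (hquad t).hasDerivWithinAt) (fun t ht => by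
      have hcs := real_inner_le_norm (gradient f (x + t • d) - gradient f x) d
      have hlip := hsmooth (x + t • d) x
      rw [add_sub_cancel_left, norm_smul, Real.norm_of_nonneg ht.1] at hlip
      rw [inner_sub_left] at hcs
      nlinarith [mul_le_mul_of_nonneg_right hlip (norm_nonneg d)])
    (Set.right_mem_Icc.2 zero_le_one)
  simpa using hle

theorem quadratic_le_of_strongConvex {f : F → ℝ} (hf : Differentiable ℝ f) {μ : ℝ}
    (hconv : ConvexOn ℝ Set.univ (fun x => f x - μ / 2 * ‖x‖ ^ 2)) (x y : F) :
    f x + inner ℝ (gradient f x) (y - x) + μ / 2 * ‖y - x‖ ^ 2 ≤ f y := by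
  obtain ⟨d, rfl⟩ : ∃ d, y = x + d := ⟨y - x, by simp⟩
  rw [add_sub_cancel_left]
  have hnorm (s : ℝ) : ‖x + s • d‖ ^ 2 = ‖x‖ ^ 2 + s * (2 * inner ℝ x d) + ‖d‖ ^ 2 * s ^ 2 := by
    rw [norm_add_sq_real, inner_smul_right, norm_smul, mul_pow, Real.norm_eq_abs, sq_abs]
    ring
  have hline : ConvexOn ℝ Set.univ
      (fun s : ℝ => f (x + s • d) - μ / 2 * ‖x + s • d‖ ^ 2) := by
    have h := hconv.comp_affineMap (AffineMap.lineMap x (x + d))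
    simpa [Function.comp_def, AffineMap.lineMap_apply, add_comm] using h
  have hderiv : HasDerivAt (fun s : ℝ => f (x + s • d) - μ / 2 * ‖x + s • d‖ ^ 2)
      (inner ℝ (gradient f x) d - μ * inner ℝ x d) 0 := by
    simp_rw [hnorm]
    have h := (hasDerivAt_comp_line hf x d 0).sub
      (((((hasDerivAt_id (0 : ℝ)).mul_const (2 * inner ℝ x d)).const_add (‖x‖ ^ 2)).add
        ((hasDerivAt_pow 2 (0 : ℝ)).const_mul (‖d‖ ^ 2))).const_mul (μ / 2))
    refine h.congr_deriv ?_
    simp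
    ring
  have hslope := hline.le_slope_of_hasDerivAt (Set.mem_univ 0) (Set.mem_univ 1) one_pos hderiv
  have hone := hnorm 1
  simp only [slope_def_field, one_smul, zero_smul, add_zero, sub_zero, div_one] at hslope hone
  rw [hone] at hslope
  linarith

theorem gradient_eq_zero_of_isMin {f : F → ℝ} {xs : F} (hmin : ∀ x, f xs ≤ f x) :
    gradient f xs = 0 := by
  have h : IsLocalMin f xs := Filter.Eventually.of_forall hmin
  rw [gradient, h.fderiv_eq_zero, map_zero]

/-- One step of accelerated gradient descent, with `q = √(L / μ)`, contracts the Lyapunov function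
`f y - f xs + μ / 2 * ‖x + q • (x - y) - xs‖ ^ 2` by the factor `1 - 1 / q`. -/
theorem agd_lyapunov_step {f : F → ℝ} (hf : Differentiable ℝ f) {L μ q : ℝ} (hμ : 0 < μ)
    (hq : 1 < q) (hL : L = μ * q ^ 2)
    (hsmooth : ∀ x y, ‖gradient f x - gradient f y‖ ≤ L * ‖x - y‖)
    (hconv : ConvexOn ℝ Set.univ (fun x => f x - μ / 2 * ‖x‖ ^ 2)) (xs x y x' y' : F)
    (hy' : y' = x - (1 / L) • gradient f x)
    (hx' : x' = y' + ((q - 1) / (q + 1)) • (y' - y)) :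
    f y' - f xs + μ / 2 * ‖x' + q • (x' - y') - xs‖ ^ 2 ≤
      (1 - 1 / q) * (f y - f xs + μ / 2 * ‖x + q • (x - y) - xs‖ ^ 2) := by
  have hq0 : 0 < q := one_pos.trans hq
  have hL0 : 0 < L := by rw [hL]; positivity
  have hdescent : f y' ≤ f x - 1 / (2 * L) * ‖gradient f x‖ ^ 2 := by
    have h := le_quadratic_of_gradient_lipschitz hf hsmooth x (-((1 / L) • gradient f x))
    rw [← sub_eq_add_neg, ← hy', inner_neg_right, inner_smul_right, real_inner_self_eq_norm_sq,
      norm_neg, norm_smul, mul_pow, Real.norm_eq_abs, sq_abs] at h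
    refine h.trans_eq ?_
    field_simp
    ring
  have hy := quadratic_le_of_strongConvex hf hconv x y
  have hxs := quadratic_le_of_strongConvex hf hconv x xs
  set g := gradient f x
  obtain ⟨a, ha⟩ : ∃ a, a = x - xs := ⟨_, rfl⟩
  obtain ⟨b, hb⟩ : ∃ b, b = x - y := ⟨_, rfl⟩
  have hv : x + q • (x - y) - xs = a + q • b - (0 : ℝ) • g := by rw [ha, hb]; module
  have hv' : x' + q • (x' - y') - xs = a + (q - 1) • b - (q / L) • g := by
    rw [ha, hb, hx', hy']
    match_scalars <;> field_simp <;> ring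
  rw [hv, hv', norm_add_smul_sub_smul_sq, norm_add_smul_sub_smul_sq]
  rw [← neg_sub x y, ← hb, inner_neg_right, norm_neg, real_inner_comm] at hy
  rw [← neg_sub x xs, ← ha, inner_neg_right, norm_neg, real_inner_comm] at hxs
  have hα : 0 < 1 / q := by positivity
  have hα1 : 0 < 1 - 1 / q := by rw [sub_pos, div_lt_one hq0]; exact hq
  have hy2 := mul_le_mul_of_nonneg_left hy hα1.le
  have hxs2 := mul_le_mul_of_nonneg_left hxs hα.le
  have hrem : 0 ≤ μ / 2 * (q - 1 / q) * ‖b‖ ^ 2 := by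
    have : 0 ≤ q - 1 / q := by linarith
    positivity
  have hid : (1 - 1 / q) * (f y - f xs + μ / 2 * (‖a‖ ^ 2 + q ^ 2 * ‖b‖ ^ 2 + 0 ^ 2 * ‖g‖ ^ 2
        + 2 * q * inner ℝ a b - 2 * 0 * inner ℝ a g - 2 * q * 0 * inner ℝ b g))
      - (f x - 1 / (2 * L) * ‖g‖ ^ 2 - f xs + μ / 2 * (‖a‖ ^ 2 + (q - 1) ^ 2 * ‖b‖ ^ 2
        + (q / L) ^ 2 * ‖g‖ ^ 2 + 2 * (q - 1) * inner ℝ a b - 2 * (q / L) * inner ℝ a g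
        - 2 * (q - 1) * (q / L) * inner ℝ b g))
      = ((1 - 1 / q) * f y - (1 - 1 / q) * (f x + -inner ℝ b g + μ / 2 * ‖b‖ ^ 2))
        + (1 / q * f xs - 1 / q * (f x + -inner ℝ a g + μ / 2 * ‖a‖ ^ 2))
        + μ / 2 * (q - 1 / q) * ‖b‖ ^ 2 := by
    rw [hL]
    field_simp
    ring
  linarith

end HilbertSpace


/-- Convergence of unquantized Nesterov accelerated gradient descent. -/
theorem agd_convergence (n : ℕ) (hn : 1 ≤ n)
    (L μ : ℝ) (hμ : 0 < μ) (hμL : μ < L)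
    (κ η γ σAGD lam : ℝ)
    (hκ : κ = L / μ) (hη : η = 1 / L)
    (hγ : γ = (Real.sqrt κ - 1) / (Real.sqrt κ + 1))
    (hσ : σAGD = Real.sqrt (1 - 1 / Real.sqrt κ))
    (hlam : lam = (1 + γ + γ / σAGD) * Real.sqrt (κ + 1))
    (f : EuclideanSpace ℝ (Fin n) → ℝ) (hf : Differentiable ℝ f)
    (hsmooth : ∀ x y : EuclideanSpace ℝ (Fin n),
      ‖gradient f x - gradient f y‖ ≤ L * ‖x - y‖)
    (hconv : ConvexOn ℝ Set.univ (fun x : EuclideanSpace ℝ (Fin n) => f x - μ / 2 * ‖x‖ ^ 2))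
    (xs : EuclideanSpace ℝ (Fin n)) (hmin : ∀ x, f xs ≤ f x)
    (x y : ℕ → EuclideanSpace ℝ (Fin n))
    (hy0 : y 0 = x 0)
    (hy : ∀ t : ℕ, y (t + 1) = x t - η • gradient f (x t))
    (hx : ∀ t : ℕ, x (t + 1) = y (t + 1) + γ • (y (t + 1) - y t)) :
    ∀ t : ℕ, ‖y t - xs‖ ≤ σAGD ^ t * Real.sqrt (κ + 1) * ‖x 0 - xs‖ ∧
      ‖x t - xs‖ ≤ σAGD ^ t * lam * ‖x 0 - xs‖ := by
  set q := Real.sqrt κ with hq_def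
  have hL : 0 < L := hμ.trans hμL
  have hκ1 : 1 < κ := by rw [hκ, one_lt_div hμ]; exact hμL
  have hq : 1 < q := by rw [hq_def, Real.lt_sqrt zero_le_one]; simpa using hκ1
  have hq0 : 0 < q := one_pos.trans hq
  have hLq : L = μ * q ^ 2 := by
    rw [hq_def, Real.sq_sqrt (by linarith), hκ]
    field_simp
  have hρ : 0 < 1 - 1 / q := by rw [sub_pos, div_lt_one hq0]; exact hq
  have hσ0 : 0 < σAGD := by rw [hσ]; exact Real.sqrt_pos.2 hρ
  have hσ2 : σAGD ^ 2 = 1 - 1 / q := by rw [hσ, Real.sq_sqrt hρ.le]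
  have hγ0 : 0 ≤ γ := by rw [hγ]; exact div_nonneg (by linarith) (by linarith)
  have hgrad := gradient_eq_zero_of_isMin hmin
  have hV : ∀ t, f (y t) - f xs + μ / 2 * ‖x t + q • (x t - y t) - xs‖ ^ 2 ≤
      (1 - 1 / q) ^ t * ((L + μ) / 2 * ‖x 0 - xs‖ ^ 2) := by
    intro t
    induction t with
    | zero =>
      have h := le_quadratic_of_gradient_lipschitz hf hsmooth xs (x 0 - xs)
      rw [hgrad, inner_zero_left, add_sub_cancel] at h
      rw [hy0, sub_self, smul_zero, add_zero, pow_zero, one_mul]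
      linarith
    | succ t ih =>
      have hstep := agd_lyapunov_step hf hμ hq hLq hsmooth hconv xs (x t) (y t) (x (t + 1))
        (y (t + 1)) (by rw [hy, hη]) (by rw [hx, hγ])
      rw [pow_succ' (1 - 1 / q), mul_assoc]
      exact hstep.trans (mul_le_mul_of_nonneg_left ih hρ.le)
  have hbound : ∀ t, ‖y t - xs‖ ≤ σAGD ^ t * Real.sqrt (κ + 1) * ‖x 0 - xs‖ := by
    intro t
    refine le_of_sq_le_sq ?_ (by positivity)
    have hsc := quadratic_le_of_strongConvex hf hconv xs (y t)
    rw [hgrad, inner_zero_left] at hsc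
    have hv : 0 ≤ μ / 2 * ‖x t + q • (x t - y t) - xs‖ ^ 2 := by positivity
    have hle : μ / 2 * ‖y t - xs‖ ^ 2 ≤
        (1 - 1 / q) ^ t * ((L + μ) / 2 * ‖x 0 - xs‖ ^ 2) := by linarith [hV t]
    have hμκ : L = μ * κ := by rw [hκ]; field_simp
    rw [mul_pow, mul_pow, Real.sq_sqrt (by linarith), ← pow_mul, mul_comm t 2, pow_mul, hσ2]
    refine le_of_mul_le_mul_left (hle.trans_eq ?_) (half_pos hμ)
    rw [hμκ]
    ring
  refine fun t => ⟨hbound t, ?_⟩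
  cases t with
  | zero =>
    have h := hbound 0
    rw [hy0, pow_zero, one_mul] at h
    rw [pow_zero, one_mul, hlam]
    refine h.trans ?_
    gcongr
    refine le_mul_of_one_le_left (Real.sqrt_nonneg _) ?_
    have : 0 ≤ γ / σAGD := by positivity
    linarith
  | succ t =>
    have hdecomp : x (t + 1) - xs = (1 + γ) • (y (t + 1) - xs) - γ • (y t - xs) := by
      rw [hx]
      module
    calc ‖x (t + 1) - xs‖
        ≤ (1 + γ) * ‖y (t + 1) - xs‖ + γ * ‖y t - xs‖ := by
          rw [hdecomp]
          refine (norm_sub_le _ _).trans_eq ?_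
          rw [norm_smul, norm_smul, Real.norm_of_nonneg hγ0, Real.norm_of_nonneg (by linarith)]
      _ ≤ (1 + γ) * (σAGD ^ (t + 1) * Real.sqrt (κ + 1) * ‖x 0 - xs‖)
          + γ * (σAGD ^ t * Real.sqrt (κ + 1) * ‖x 0 - xs‖) := by
          gcongr
          · exact hbound (t + 1)
          · exact hbound t
      _ = σAGD ^ (t + 1) * lam * ‖x 0 - xs‖ := by
          rw [hlam]
          field_simp
          ring
end
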